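/- Let K be a field, S = K[x_1,...,x_n], and let I = I_0 ⊆ I_1 ⊆ ... ⊆ I_r = S be an ascending chain of monomial ideals of S such that each quotient I_j/I_{j−1} is a cyclic S-module, so I_j/I_{j−1} ≅ (S/L_j)(−a_j) for some monomial ideal L_j ⊂ S and some multidegree shift a_j ∈ Z^n. Then sdepth(S/I) ≥ min{ sdepth(S/L_j) : j = 1,...,r }. -/

import Mathlib

/-!
STATEMENT 3 (Lemma 1.3): Let `K` be a field, `S = K[x_1,…,x_n]`, and let
`I = I_0 ⊆ I_1 ⊆ … ⊆ I_r = S` be an ascending chain of monomial ideals such that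
each quotient `I_j/I_{j−1}` is cyclic, so `I_j/I_{j−1} ≅ (S/L_j)(−a_j)` as
`ℤⁿ`-graded modules.  For monomial ideals this graded isomorphism amounts to:
`I_j = I_{j−1} + (x^{a_j})` and `L_j = I_{j−1} : x^{a_j}`.  Then
`sdepth(S/I) ≥ min { sdepth(S/L_j) : j = 1,…,r }`.
-/

open MvPolynomial

noncomputable section

variable (K : Type*) [Field K] {n : ℕ}
open MvPolynomial

noncomputable section

variable (K : Type*) [Field K] {n : ℕ}

/-- A monomial ideal: an ideal generated by monomials. -/
def IsMonomialIdeal (I : Ideal (MvPolynomial (Fin n) K)) : Prop :=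
  ∃ A : Set (Fin n →₀ ℕ),
    I = Ideal.span ((fun d => (monomial d (1 : K) : MvPolynomial (Fin n) K)) '' A)

/-- The Stanley space `u·K[Z]`: the `K`-subspace of `K[x_1,…,x_n]` spanned by all
monomials `u·v` where `v` is a monomial in the variables of `Z`. -/
def stanleySpace (u : Fin n →₀ ℕ) (Z : Finset (Fin n)) : Submodule K (MvPolynomial (Fin n) K) :=
  Submodule.span K
    ((fun e => (monomial (u + e) (1 : K) : MvPolynomial (Fin n) K)) ''
      {e : Fin n →₀ ℕ | ∀ i ∉ Z, e i = 0})

/-- `I^c`: the `K`-subspace of `S` spanned by all monomials not belonging to `I`. -/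
def monomialComplement (I : Ideal (MvPolynomial (Fin n) K)) :
    Submodule K (MvPolynomial (Fin n) K) :=
  Submodule.span K
    {f : MvPolynomial (Fin n) K | ∃ d : Fin n →₀ ℕ, f = monomial d (1 : K) ∧ f ∉ I}

/-- A Stanley decomposition of `S/I`: a presentation of `I^c` as a finite direct
sum of Stanley spaces. -/
structure StanleyDecomposition (I : Ideal (MvPolynomial (Fin n) K)) where
  r : ℕ
  u : Fin r → (Fin n →₀ ℕ)
  Z : Fin r → Finset (Fin n)
  indep : iSupIndep fun i => stanleySpace K (u i) (Z i)
  sup_eq : ⨆ i, stanleySpace K (u i) (Z i) = monomialComplement K I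

/-- The Stanley depth of `S/I`: the maximum, over all Stanley decompositions `D` of `S/I`,
of the minimal dimension `|Z_i|` of a Stanley space occurring in `D`. -/
def sdepth (I : Ideal (MvPolynomial (Fin n) K)) : ℕ :=
  sSup {d : ℕ | ∃ D : StanleyDecomposition K I, ∀ i, d ≤ (D.Z i).card}


/-- The exponents of the monomials in the Stanley space `u·K[Z]`. -/
def stanleyCell {n : ℕ} (u : Fin n →₀ ℕ) (Z : Finset (Fin n)) : Set (Fin n →₀ ℕ) :=
  (fun e => u + e) '' {e : Fin n →₀ ℕ | ∀ i ∉ Z, e i = 0}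

/-- The exponents of the monomials outside `I`. -/
def standardExponents {K : Type*} [Field K] {n : ℕ} (I : Ideal (MvPolynomial (Fin n) K)) :
    Set (Fin n →₀ ℕ) :=
  {d | (monomial d (1 : K) : MvPolynomial (Fin n) K) ∉ I}

/-- `A` is a finite disjoint union of Stanley cells of dimension at least `m`. -/
def HasCellPartition {n : ℕ} (m : ℕ) (A : Set (Fin n →₀ ℕ)) : Prop :=
  ∃ (r : ℕ) (u : Fin r → (Fin n →₀ ℕ)) (Z : Fin r → Finset (Fin n)),
    Pairwise (fun i j => Disjoint (stanleyCell (u i) (Z i)) (stanleyCell (u j) (Z j))) ∧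
    ⋃ i, stanleyCell (u i) (Z i) = A ∧ ∀ i, m ≤ (Z i).card

theorem stanleySpace_eq_restrictSupport {K : Type*} [Field K] {n : ℕ} (u : Fin n →₀ ℕ)
    (Z : Finset (Fin n)) : stanleySpace K u Z = restrictSupport K (stanleyCell u Z) := by
  rw [restrictSupport_eq_span, stanleyCell, Set.image_image]
  rfl

theorem monomialComplement_eq_restrictSupport {K : Type*} [Field K] {n : ℕ}
    (I : Ideal (MvPolynomial (Fin n) K)) :
    monomialComplement K I = restrictSupport K (standardExponents I) := by
  rw [restrictSupport_eq_span, monomialComplement]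
  congr 1
  ext f
  constructor
  · rintro ⟨d, rfl, hd⟩
    exact ⟨d, hd, rfl⟩
  · rintro ⟨d, hd, rfl⟩
    exact ⟨d, rfl, hd⟩

theorem disjoint_restrictSupport_iff {K : Type*} [Field K] {σ : Type*} {s t : Set (σ →₀ ℕ)} :
    Disjoint (restrictSupport K s) (restrictSupport K t) ↔ Disjoint s t := by
  rw [Submodule.disjoint_def, Set.disjoint_left]
  constructor
  · intro h d hs ht
    have := h (monomial d 1) ((monomial_mem_restrictSupport K).2 (.inl hs))
      ((monomial_mem_restrictSupport K).2 (.inl ht))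
    simp at this
  · intro h f hs ht
    rw [mem_restrictSupport_iff] at hs ht
    rw [← support_eq_empty, Finset.eq_empty_iff_forall_notMem]
    exact fun d hd => h (hs hd) (ht hd)

theorem iSup_restrictSupport {K : Type*} [Field K] {σ : Type*} {ι : Sort*} (s : ι → Set (σ →₀ ℕ)) :
    ⨆ i, restrictSupport K (s i) = restrictSupport K (⋃ i, s i) := by
  simp_rw [restrictSupport_eq_span, Set.image_iUnion, Submodule.span_iUnion]

theorem restrictSupport_inj {K : Type*} [Field K] {σ : Type*} {s t : Set (σ →₀ ℕ)} :
    restrictSupport K s = restrictSupport K t ↔ s = t := by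
  refine ⟨fun h => Set.ext fun d => ?_, fun h => h ▸ rfl⟩
  have := SetLike.ext_iff.1 h (monomial d 1)
  simpa [monomial_mem_restrictSupport] using this

theorem iSupIndep_restrictSupport_iff {K : Type*} [Field K] {σ ι : Type*}
    {s : ι → Set (σ →₀ ℕ)} :
    (iSupIndep fun i => restrictSupport K (s i)) ↔
      Pairwise (fun i j => Disjoint (s i) (s j)) := by
  constructor
  · exact fun h i j hij => disjoint_restrictSupport_iff.1 (h.pairwiseDisjoint hij)
  · intro h i
    change Disjoint _ (⨆ j, ⨆ (_ : j ≠ i), restrictSupport K (s j))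
    simp_rw [iSup_restrictSupport, disjoint_restrictSupport_iff, Set.disjoint_iUnion_right]
    exact fun j hj => h hj.symm

theorem exists_stanleyDecomposition_iff {K : Type*} [Field K] {n : ℕ}
    {I : Ideal (MvPolynomial (Fin n) K)} {m : ℕ} :
    (∃ D : StanleyDecomposition K I, ∀ i, m ≤ (D.Z i).card) ↔
      HasCellPartition m (standardExponents I) := by
  constructor
  · rintro ⟨⟨r, u, Z, hind, hsup⟩, hD⟩
    simp_rw [stanleySpace_eq_restrictSupport] at hind hsup
    rw [iSup_restrictSupport, monomialComplement_eq_restrictSupport, restrictSupport_inj] at hsup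
    exact ⟨r, u, Z, iSupIndep_restrictSupport_iff.1 hind, hsup, hD⟩
  · rintro ⟨r, u, Z, hdisj, hunion, hZ⟩
    refine ⟨⟨r, u, Z, ?_, ?_⟩, hZ⟩
    · simp_rw [stanleySpace_eq_restrictSupport]
      exact iSupIndep_restrictSupport_iff.2 hdisj
    · simp_rw [stanleySpace_eq_restrictSupport]
      rw [iSup_restrictSupport, monomialComplement_eq_restrictSupport, hunion]

theorem sdepth_eq_sSup_hasCellPartition {K : Type*} [Field K] {n : ℕ}
    (I : Ideal (MvPolynomial (Fin n) K)) :
    sdepth K I = sSup {m | HasCellPartition m (standardExponents I)} := by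
  simp_rw [sdepth, exists_stanleyDecomposition_iff]

namespace HasCellPartition

theorem mono {n m k : ℕ} {A : Set (Fin n →₀ ℕ)} (h : HasCellPartition m A) (hk : k ≤ m) :
    HasCellPartition k A := by
  obtain ⟨r, u, Z, hdisj, hunion, hZ⟩ := h
  exact ⟨r, u, Z, hdisj, hunion, fun i => hk.trans (hZ i)⟩

theorem empty {n : ℕ} (m : ℕ) : HasCellPartition m (∅ : Set (Fin n →₀ ℕ)) :=
  ⟨0, Fin.elim0, Fin.elim0, fun i => i.elim0, by simp, fun i => i.elim0⟩

theorem le_of_nonempty {n m : ℕ} {A : Set (Fin n →₀ ℕ)} (h : HasCellPartition m A)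
    (hA : A.Nonempty) : m ≤ n := by
  obtain ⟨r, u, Z, -, rfl, hZ⟩ := h
  obtain ⟨i, -⟩ := Set.nonempty_iUnion.1 hA
  exact (hZ i).trans (by simpa using Finset.card_le_univ (Z i))

theorem union {n m : ℕ} {A B : Set (Fin n →₀ ℕ)} (hA : HasCellPartition m A)
    (hB : HasCellPartition m B) (hAB : Disjoint A B) : HasCellPartition m (A ∪ B) := by
  obtain ⟨r, u, Z, hdisj, rfl, hZ⟩ := hA
  obtain ⟨s, v, W, hdisj', rfl, hW⟩ := hB
  simp_rw [Set.disjoint_iUnion_left, Set.disjoint_iUnion_right] at hAB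
  refine ⟨r + s, Fin.append u v, Fin.append Z W, ?_, ?_, ?_⟩
  · intro i j
    refine Fin.addCases (fun i => ?_) (fun i => ?_) i <;>
      refine Fin.addCases (fun j => ?_) (fun j => ?_) j <;> intro hij
    · simpa using hdisj (fun h : i = j => hij (congrArg _ h))
    · simpa using hAB i j
    · simpa using (hAB j i).symm
    · simpa using hdisj' (fun h : i = j => hij (congrArg _ h))
  · ext d
    simp only [Set.mem_union, Set.mem_iUnion]
    constructor
    · rintro ⟨i, hi⟩
      induction i using Fin.addCases with
      | left i => exact .inl ⟨i, by simpa using hi⟩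
      | right i => exact .inr ⟨i, by simpa using hi⟩
    · rintro (⟨i, hi⟩ | ⟨i, hi⟩)
      · exact ⟨Fin.castAdd s i, by simpa using hi⟩
      · exact ⟨Fin.natAdd r i, by simpa using hi⟩
  · intro i
    induction i using Fin.addCases with
    | left i => simpa using hZ i
    | right i => simpa using hW i

theorem translate {n m : ℕ} {A : Set (Fin n →₀ ℕ)} (h : HasCellPartition m A)
    (a : Fin n →₀ ℕ) : HasCellPartition m ((fun e => a + e) '' A) := by
  obtain ⟨r, u, Z, hdisj, rfl, hZ⟩ := h
  have hcell (i) : stanleyCell (a + u i) (Z i) = (fun e => a + e) '' stanleyCell (u i) (Z i) := by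
    simp [stanleyCell, Set.image_image, add_assoc]
  refine ⟨r, fun i => a + u i, Z, fun i j hij => ?_, ?_, hZ⟩
  · simpa only [hcell] using (Set.disjoint_image_iff (add_right_injective a)).2 (hdisj hij)
  · simp_rw [hcell, Set.image_iUnion]

end HasCellPartition

theorem IsMonomialIdeal.monomial_mem_sup_span_iff {K : Type*} [Field K] {n : ℕ}
    {I : Ideal (MvPolynomial (Fin n) K)} (hI : IsMonomialIdeal K I) (a d : Fin n →₀ ℕ) :
    (monomial d (1 : K) : MvPolynomial (Fin n) K) ∈
        I ⊔ Ideal.span {(monomial a (1 : K) : MvPolynomial (Fin n) K)} ↔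
      (monomial d (1 : K) : MvPolynomial (Fin n) K) ∈ I ∨ a ≤ d := by
  obtain ⟨A, rfl⟩ := hI
  rw [← Set.image_singleton (f := fun d => (monomial d (1 : K) : MvPolynomial (Fin n) K)),
    ← Ideal.span_union, ← Set.image_union]
  simp [mem_ideal_span_monomial_image, or_comm]

theorem standardExponents_eq_union {K : Type*} [Field K] {n : ℕ}
    {I : Ideal (MvPolynomial (Fin n) K)} (hI : IsMonomialIdeal K I) (a : Fin n →₀ ℕ) :
    standardExponents I =
      standardExponents (I ⊔ Ideal.span {(monomial a (1 : K) : MvPolynomial (Fin n) K)}) ∪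
        (fun e => a + e) '' standardExponents
          (I.colon (Ideal.span {(monomial a (1 : K) : MvPolynomial (Fin n) K)})) := by
  ext d
  simp only [standardExponents, Set.mem_union, Set.mem_ofPred_eq, Set.mem_image,
    hI.monomial_mem_sup_span_iff, Ideal.mem_colon_span_singleton, monomial_mul, mul_one, not_or]
  constructor
  · intro hd
    by_cases had : a ≤ d
    · exact .inr ⟨d - a, by rwa [tsub_add_cancel_of_le had], add_tsub_cancel_of_le had⟩
    · exact .inl ⟨hd, had⟩
  · rintro (⟨hd, -⟩ | ⟨e, he, rfl⟩)
    · exact hd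
    · rwa [add_comm]

theorem disjoint_standardExponents_sup_translate {K : Type*} [Field K] {n : ℕ}
    (I : Ideal (MvPolynomial (Fin n) K)) (a : Fin n →₀ ℕ) (B : Set (Fin n →₀ ℕ)) :
    Disjoint
      (standardExponents (I ⊔ Ideal.span {(monomial a (1 : K) : MvPolynomial (Fin n) K)}))
      ((fun e => a + e) '' B) := by
  rw [Set.disjoint_right]
  rintro _ ⟨e, -, rfl⟩ h
  refine h (Ideal.mem_sup_right (Ideal.mem_span_singleton.2 ⟨monomial e 1, ?_⟩))
  simp [monomial_mul]

theorem standardExponents_top {K : Type*} [Field K] {n : ℕ} :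
    standardExponents (⊤ : Ideal (MvPolynomial (Fin n) K)) = ∅ := by
  simp [standardExponents]

theorem standardExponents_nonempty {K : Type*} [Field K] {n : ℕ}
    {I : Ideal (MvPolynomial (Fin n) K)} (hI : I ≠ ⊤) : (standardExponents I).Nonempty :=
  ⟨0, fun h => hI ((Ideal.eq_top_iff_one I).2 h)⟩

theorem sdepth_top {K : Type*} [Field K] {n : ℕ} :
    sdepth K (⊤ : Ideal (MvPolynomial (Fin n) K)) = 0 := by
  have : {m | HasCellPartition m (∅ : Set (Fin n →₀ ℕ))} = Set.univ :=
    Set.eq_univ_of_forall HasCellPartition.empty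
  rw [sdepth_eq_sSup_hasCellPartition, standardExponents_top, this]
  exact Nat.sSup_of_not_bddAbove not_bddAbove_univ

theorem hasCellPartition_sdepth {K : Type*} [Field K] {n : ℕ}
    {I : Ideal (MvPolynomial (Fin n) K)} (h : 0 < sdepth K I) :
    HasCellPartition (sdepth K I) (standardExponents I) := by
  rw [sdepth_eq_sSup_hasCellPartition] at h ⊢
  refine Nat.sSup_mem (s := {m | HasCellPartition m (standardExponents I)})
    (Set.nonempty_iff_ne_empty.2 fun he => ?_) (by_contra fun hb => ?_)
  · simp [he] at h
  · simp [Nat.sSup_of_not_bddAbove hb] at h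

theorem HasCellPartition.le_sdepth {K : Type*} [Field K] {n m : ℕ}
    {I : Ideal (MvPolynomial (Fin n) K)} (h : HasCellPartition m (standardExponents I))
    (hI : I ≠ ⊤) : m ≤ sdepth K I := by
  rw [sdepth_eq_sSup_hasCellPartition]
  exact le_csSup ⟨n, fun _ hk => hk.le_of_nonempty (standardExponents_nonempty hI)⟩ h

theorem sdepth_ge_min_of_cyclic_filtration {K : Type*} [Field K] {n : ℕ} (r : ℕ)
    (I : Fin (r + 1) → Ideal (MvPolynomial (Fin n) K))
    (hmono : ∀ j : Fin (r + 1), IsMonomialIdeal K (I j))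
    (hchain : ∀ j : Fin r, I j.castSucc ≤ I j.succ)
    (hlast : I (Fin.last r) = ⊤)
    (a : Fin r → (Fin n →₀ ℕ))
    (L : Fin r → Ideal (MvPolynomial (Fin n) K))
    (hcyclic : ∀ j : Fin r,
      I j.succ = I j.castSucc ⊔ Ideal.span {(monomial (a j) (1 : K) : MvPolynomial (Fin n) K)})
    (hL : ∀ j : Fin r,
      L j = (I j.castSucc).colon (Ideal.span {(monomial (a j) (1 : K) : MvPolynomial (Fin n) K)})) :
    sInf (Set.range fun j : Fin r => sdepth K (L j)) ≤ sdepth K (I 0) := by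
  set m := sInf (Set.range fun j : Fin r => sdepth K (L j)) with hm
  rcases Nat.eq_zero_or_pos m with h0 | hpos
  · simp [h0]
  have hle (j : Fin r) : m ≤ sdepth K (L j) := Nat.sInf_le ⟨j, rfl⟩
  have hr : 0 < r := by
    refine Nat.pos_of_ne_zero fun hr => ?_
    subst hr
    simp [hm] at hpos
  have hpart (j : Fin (r + 1)) : HasCellPartition m (standardExponents (I j)) := by
    induction j using Fin.reverseInduction with
    | last =>
      rw [hlast, standardExponents_top]
      exact .empty m
    | cast j ih =>
      have hLj := (hasCellPartition_sdepth (hpos.trans_le (hle j))).mono (hle j)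
      rw [hcyclic j] at ih
      rw [hL j] at hLj
      rw [standardExponents_eq_union (hmono j.castSucc) (a j)]
      exact ih.union (hLj.translate (a j)) (disjoint_standardExponents_sup_translate _ _ _)
  refine (hpart 0).le_sdepth fun htop => ?_
  have hL0 : L ⟨0, hr⟩ = ⊤ := by
    have hI0 : I (Fin.castSucc ⟨0, hr⟩) = ⊤ := htop
    rw [hL, hI0]
    exact (Ideal.eq_top_iff_one _).2 (Ideal.mem_colon_span_singleton.2 Submodule.mem_top)
  have := hle ⟨0, hr⟩
  rw [hL0, sdepth_top] at this
  omega

end
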